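/- Let T = (e₁,…,e₅) be a list of five 4-tuples of pairwise distinct indices in {1,…,8} covering every index, and suppose some vertex v ∈ {1,…,8} belongs to at least four of the five tuples e₁,…,e₅. Then the cross-ratio degree of T is at most 2: there exists a nonzero polynomial q ∈ ℂ[x₁,…,x₅] such that N_T(a) ≤ 2 for every a ∈ (ℂ∖{0,1})⁵ with q(a) ≠ 0. -/

import Mathlib

open OnePoint

/-- Cross-ratio of four points of `ℙ¹(ℂ) = OnePoint ℂ`:
`CR(z₁,z₂,z₃,z₄) = ((z₃−z₁)(z₄−z₂))/((z₃−z₂)(z₄−z₁))` when all points are finite,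
extended to one point at infinity by omitting the two factors containing it. -/
noncomputable def CR : OnePoint ℂ → OnePoint ℂ → OnePoint ℂ → OnePoint ℂ → ℂ
  | Option.none,    Option.some z₂, Option.some z₃, Option.some z₄ => (z₄ - z₂) / (z₃ - z₂)
  | Option.some z₁, Option.none,    Option.some z₃, Option.some z₄ => (z₃ - z₁) / (z₄ - z₁)
  | Option.some z₁, Option.some z₂, Option.none,    Option.some z₄ => (z₄ - z₂) / (z₄ - z₁)
  | Option.some z₁, Option.some z₂, Option.some z₃, Option.none    => (z₃ - z₁) / (z₃ - z₂)
  | Option.some z₁, Option.some z₂, Option.some z₃, Option.some z₄ =>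
      ((z₃ - z₁) * (z₄ - z₂)) / ((z₃ - z₂) * (z₄ - z₁))
  | _, _, _, _ => 0

/-- The degree of a vertex `v` with respect to the datum `T`:
the number of indices `i` such that `v` occurs in the tuple `eᵢ = T i`. -/
def degT (T : Fin 5 → Fin 4 → Fin 8) (v : Fin 8) : ℕ :=
  (Finset.univ.filter fun i => ∃ j, T i j = v).card

open MvPolynomial in
/-- A polynomial relation between fractions specializes to points where no denominator vanishes. -/
theorem MvPolynomial.eval_eq_zero_of_aeval_div_eq_zero {σ τ k K : Type*} [Field k]
    [Field K] [Algebra (MvPolynomial σ k) K] [IsFractionRing (MvPolynomial σ k) K] [Algebra k K]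
    [IsScalarTower k (MvPolynomial σ k) K] (A B : τ → MvPolynomial σ k) (P : MvPolynomial τ k)
    (hP : aeval (fun i => algebraMap (MvPolynomial σ k) K (A i) /
      algebraMap (MvPolynomial σ k) K (B i)) P = 0)
    (x : σ → k) (hB : ∀ i, eval x (B i) ≠ 0) :
    eval (fun i => eval x (A i) / eval x (B i)) P = 0 := by
  let R := MvPolynomial σ k
  let M : Submonoid R := (nonZeroDivisors k).comap (eval x)
  have hM : M ≤ nonZeroDivisors R := by
    intro r hr
    rw [mem_nonZeroDivisors_iff_ne_zero]
    rintro rfl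
    exact nonZeroDivisors.ne_zero (show eval x (0 : R) ∈ nonZeroDivisors k from hr) (map_zero _)
  have hBM (i) : B i ∈ M := mem_nonZeroDivisors_of_ne_zero (hB i)
  have hφ (y : M) : IsUnit (algebraMap R K y) :=
    IsLocalization.map_units K (⟨y, hM y.2⟩ : nonZeroDivisors R)
  have hψ (y : M) : IsUnit (eval x (y : R)) := isUnit_iff_ne_zero.2 (nonZeroDivisors.ne_zero y.2)
  let φ : Localization M →+* K := IsLocalization.lift hφ
  let ψ : Localization M →+* k := IsLocalization.lift hψ
  have φ_inj : Function.Injective φ := by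
    rw [IsLocalization.lift_injective_iff]
    intro a b
    rw [(IsLocalization.injective (Localization M) hM).eq_iff,
      (IsFractionRing.injective R K).eq_iff]
  let g : τ → Localization M := fun i => IsLocalization.mk' _ (A i) ⟨B i, hBM i⟩
  have hφg (i) : φ (g i) = algebraMap R K (A i) / algebraMap R K (B i) := by
    rw [eq_div_iff (hφ ⟨B i, hBM i⟩).ne_zero, mul_comm]
    exact ((IsLocalization.lift_mk'_spec (S := Localization M) _ (A i) _ ⟨B i, hBM i⟩).1 rfl).symm
  have hψg (i) : ψ (g i) = eval x (A i) / eval x (B i) := by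
    rw [eq_div_iff (hB i), mul_comm]
    exact ((IsLocalization.lift_mk'_spec (S := Localization M) _ (A i) _ ⟨B i, hBM i⟩).1 rfl).symm
  let c : k →+* Localization M := (algebraMap R (Localization M)).comp C
  have hφc : φ.comp c = algebraMap k K := by
    ext r
    simp only [φ, c, RingHom.comp_apply, IsLocalization.lift_eq]
    exact (IsScalarTower.algebraMap_apply k R K r).symm
  have hψc : ψ.comp c = RingHom.id k := by
    ext r
    simp only [ψ, c, RingHom.comp_apply, IsLocalization.lift_eq]
    exact eval_C r
  have h0 : eval₂ c g P = 0 := by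
    apply φ_inj
    rw [hom_eval₂, hφc, map_zero, ← hP]
    simp only [hφg]
    rfl
  have h1 := congrArg ψ h0
  rw [hom_eval₂, hψc, map_zero] at h1
  simp only [hψg] at h1
  exact h1

open MvPolynomial in
/-- The generic fiber of a rational map to a space of at least the same dimension is finite. -/
theorem MvPolynomial.exists_finite_fiber {σ ι : Type} {k : Type} [Field k] [Fintype σ] [Fintype ι]
    (h : Fintype.card σ ≤ Fintype.card ι) (A B : ι → MvPolynomial σ k) :
    ∃ q : MvPolynomial ι k, q ≠ 0 ∧ ∀ a, eval a q ≠ 0 →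
      {x : σ → k | ∀ i, eval x (B i) ≠ 0 ∧ eval x (A i) = a i * eval x (B i)}.Finite := by
  let R := MvPolynomial σ k
  let K := FractionRing R
  let A' (j : σ) : Option ι → R := fun o => o.elim (X j) A
  let B' : Option ι → R := fun o => o.elim 1 B
  have trdeg : Algebra.trdeg k K = Fintype.card σ := by
    have h1 := trdeg_add_eq k R (A := K)
    rw [MvPolynomial.trdeg_of_isDomain] at h1
    have h2 : Algebra.IsAlgebraic R K := IsLocalization.isAlgebraic K (nonZeroDivisors R)
    have h3 : Algebra.trdeg R K = 0 := trdeg_eq_zero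
    rw [h3, add_zero] at h1
    simpa using h1.symm
  have key (j : σ) : ∃ P : MvPolynomial (Option ι) k, P ≠ 0 ∧
      aeval (fun i => algebraMap R K (A' j i) / algebraMap R K (B' i)) P = 0 := by
    by_contra! hc
    have : AlgebraicIndependent k (fun i => algebraMap R K (A' j i) / algebraMap R K (B' i)) := by
      rw [algebraicIndependent_iff]
      intro p hp
      by_contra h0
      exact hc p h0 hp
    have := this.cardinalMk_le_trdeg
    rw [trdeg, Cardinal.mk_fintype, Nat.cast_le, Fintype.card_option] at this
    omega
  choose P hP0 hP using key
  let p (j : σ) := optionEquivLeft k ι (P j)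
  have hp (j) : p j ≠ 0 := by simpa [p] using hP0 j
  refine ⟨∏ j, (p j).leadingCoeff, Finset.prod_ne_zero_iff.2 fun j _ => by simpa using hp j, ?_⟩
  intro a ha
  rw [map_prod, Finset.prod_ne_zero_iff] at ha
  have hpa (j) : (p j).map (eval a) ≠ 0 := fun h0 => ha j (Finset.mem_univ j) (by
    simpa using congrArg (fun f => f.coeff (p j).natDegree) h0)
  refine (Set.Finite.pi (t := fun j => {t | ((p j).map (eval a)).IsRoot t})
    fun j => Polynomial.finite_setOfPred_isRoot (hpa j)).subset ?_
  intro x hx j _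
  have := eval_eq_zero_of_aeval_div_eq_zero (A' j) B' (P j) (hP j) x
    (fun o => by cases o with
      | none => simp [B']
      | some i => exact (hx i).1)
  rw [Set.mem_ofPred_eq, Polynomial.IsRoot, ← optionEquivLeft_elim_eval, ← this]
  congr 2
  ext o
  cases o with
  | none => simp [A', B']
  | some i => exact ((div_eq_iff (hx i).1).2 (hx i).2).symm

/-- If `f` vanishes along a line through `x`, it has infinitely many zeros in `x + H` off any
finitely many hyperplanes avoiding `x`. -/
theorem infinite_setOf_line {V κ : Type*} [AddCommGroup V] [Module ℂ V] [Finite κ]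
    (H : Submodule ℂ V) (f : V → ℂ) (D : κ → V →ₗ[ℂ] ℂ) {x u : V} (hu : u ∈ H) (hu0 : u ≠ 0)
    (hf : ∀ t : ℂ, f (x + t • u) = 0) (hD : ∀ k, D k x ≠ 0) :
    {w | w ∈ H ∧ f (x + w) = 0 ∧ ∀ k, D k (x + w) ≠ 0}.Infinite := by
  have hfin : {t : ℂ | ∃ k, D k x + t * D k u = 0}.Finite := by
    rw [Set.ofPred_exists]
    refine Set.finite_iUnion fun k => Set.Subsingleton.finite ?_
    intro s hs t ht
    simp only [Set.mem_ofPred_eq] at hs ht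
    have hku : D k u ≠ 0 := by
      intro h0
      exact hD k (by simpa [h0] using hs)
    exact mul_right_cancel₀ hku (by linear_combination hs - ht)
  have hinj : Function.Injective fun t : ℂ => t • u := smul_left_injective ℂ hu0
  refine (hfin.infinite_compl.image hinj.injOn).mono ?_
  rintro _ ⟨t, ht, rfl⟩
  refine ⟨H.smul_mem _ hu, hf t, fun k h0 => ht ⟨k, by simpa using h0⟩⟩

/-- A quadric meeting an affine plane through `x` contains infinitely many points of it off any
finitely many hyperplanes avoiding `x`. -/
theorem infinite_setOf_conic {V κ : Type*} [AddCommGroup V] [Module ℂ V] [Finite κ]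
    (H : Submodule ℂ V) (f : V → ℂ) (D : κ → V →ₗ[ℂ] ℂ) {x u₀ u₁ : V}
    (hu₀ : u₀ ∈ H) (hu₁ : u₁ ∈ H) (hli : LinearIndependent ℂ ![u₀, u₁]) {b q₀ q₁ q₂ : ℂ}
    (hf : ∀ α β : ℂ, f (x + (α • u₀ + β • u₁)) = β * b + α ^ 2 * q₀ + α * β * q₁ + β ^ 2 * q₂)
    (hD : ∀ k, D k x ≠ 0) :
    {w | w ∈ H ∧ f (x + w) = 0 ∧ ∀ k, D k (x + w) ≠ 0}.Infinite := by
  rw [LinearIndependent.pair_iff] at hli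
  by_cases hq₀ : q₀ = 0
  · refine infinite_setOf_line H f D hu₀ ?_ (fun t => ?_) hD
    · rintro rfl
      simpa using hli 1 0
    · simpa [hq₀] using hf t 0
  by_cases hb : b = 0
  · obtain ⟨α, hα⟩ := exists_quadratic_eq_zero (b := q₁) (c := q₂) hq₀
      (IsAlgClosed.exists_eq_mul_self _)
    refine infinite_setOf_line H f D (u := α • u₀ + (1 : ℂ) • u₁)
      (H.add_mem (H.smul_mem _ hu₀) (H.smul_mem _ hu₁)) (fun h0 => ?_) (fun t => ?_) hD
    · simpa using hli α 1 h0
    · rw [smul_add, smul_smul, smul_smul, hf, hb]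
      linear_combination t ^ 2 * hα
  have hfin : {t : ℂ | t = 0 ∨ q₀ + t * q₁ + t ^ 2 * q₂ = 0 ∨ ∃ k,
      (q₀ + t * q₁ + t ^ 2 * q₂) * D k x - t * b * (D k u₀ + t * D k u₁) = 0}.Finite := by
    have quad (c₀ c₁ c₂ : ℂ) (h : c₀ ≠ 0) : {t : ℂ | c₀ + t * c₁ + t ^ 2 * c₂ = 0}.Finite := by
      open Polynomial in
      have hp : (C c₀ + X * C c₁ + X ^ 2 * C c₂ : ℂ[X]) ≠ 0 := fun h0 => h (by
        simpa using congrArg (Polynomial.eval 0) h0)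
      refine (Polynomial.finite_setOfPred_isRoot hp).subset fun t ht => ?_
      have ht : c₀ + t * c₁ + t ^ 2 * c₂ = 0 := ht
      simp only [Set.mem_ofPred_eq, Polynomial.IsRoot, Polynomial.eval_add, Polynomial.eval_mul,
        Polynomial.eval_pow, Polynomial.eval_X, Polynomial.eval_C]
      exact ht
    rw [Set.ofPred_or, Set.ofPred_or, Set.ofPred_exists]
    refine (Set.finite_singleton 0).union ((quad _ _ _ hq₀).union (Set.finite_iUnion fun k => ?_))
    refine (quad (q₀ * D k x) (q₁ * D k x - b * D k u₀) (q₂ * D k x - b * D k u₁)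
      (mul_ne_zero hq₀ (hD k))).subset fun t ht => ?_
    simp only [Set.mem_ofPred_eq] at ht ⊢
    linear_combination ht
  let α (t : ℂ) : ℂ := -(t * b) / (q₀ + t * q₁ + t ^ 2 * q₂)
  refine (hfin.infinite_compl.image (f := fun t => α t • u₀ + (α t * t) • u₁) ?_).mono ?_
  · intro s hs t ht hst
    simp only [Set.mem_compl_iff, Set.mem_ofPred_eq, not_or] at hs ht
    have hα : α s ≠ 0 := div_ne_zero (neg_ne_zero.2 (mul_ne_zero hs.1 hb)) hs.2.1
    have := hli (α s - α t) (α s * s - α t * t) (by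
      rw [sub_smul, sub_smul]
      simp only at hst
      rw [← sub_eq_zero] at hst
      rw [← hst]
      abel)
    exact mul_left_cancel₀ hα (by linear_combination this.2 - t * this.1)
  · rintro _ ⟨t, ht, rfl⟩
    simp only [Set.mem_compl_iff, Set.mem_ofPred_eq, not_or, not_exists] at ht
    obtain ⟨ht0, hc, hk⟩ := ht
    have hα : α t * (q₀ + t * q₁ + t ^ 2 * q₂) = -(t * b) := div_mul_cancel₀ _ hc
    refine ⟨H.add_mem (H.smul_mem _ hu₀) (H.smul_mem _ hu₁), ?_, fun k h0 => hk k ?_⟩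
    · rw [hf]
      linear_combination α t * hα
    · simp only [map_add, LinearMap.map_smul, smul_eq_mul] at h0
      linear_combination (q₀ + t * q₁ + t ^ 2 * q₂) * h0 - (D k u₀ + t * D k u₁) * hα

/-- If an affine subspace contains three points of a quadric, one of them off finitely many
hyperplanes, then it contains infinitely many points of the quadric off these hyperplanes. -/
theorem infinite_of_three_points {V κ : Type*} [AddCommGroup V] [Module ℂ V] [Finite κ]
    (H : Submodule ℂ V) (l₁ l₂ l₃ l₄ : V →ₗ[ℂ] ℂ) (a : ℂ) (D : κ → V →ₗ[ℂ] ℂ) {x y z : V}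
    (hxy : x ≠ y) (hxz : x ≠ z) (hyz : y ≠ z) (hy : y - x ∈ H) (hz : z - x ∈ H)
    (hQx : l₁ x * l₂ x = a * (l₃ x * l₄ x)) (hQy : l₁ y * l₂ y = a * (l₃ y * l₄ y))
    (hQz : l₁ z * l₂ z = a * (l₃ z * l₄ z)) (hD : ∀ k, D k x ≠ 0) :
    {w | w ∈ H ∧ l₁ (x + w) * l₂ (x + w) - a * (l₃ (x + w) * l₄ (x + w)) = 0 ∧
      ∀ k, D k (x + w) ≠ 0}.Infinite := by
  let f (w : V) : ℂ := l₁ w * l₂ w - a * (l₃ w * l₄ w)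
  let q (w : V) : ℂ := l₁ w * l₂ w - a * (l₃ w * l₄ w)
  let B (v w : V) : ℂ := l₁ v * l₂ w + l₁ w * l₂ v - a * (l₃ v * l₄ w + l₃ w * l₄ v)
  obtain ⟨u, hu⟩ : ∃ u, u = y - x := ⟨_, rfl⟩
  obtain ⟨v, hv⟩ : ∃ v, v = z - x := ⟨_, rfl⟩
  have hyu : y = x + u := by rw [hu]; abel
  have hzv : z = x + v := by rw [hv]; abel
  have hu0 : u ≠ 0 := by rintro rfl; simp at hyu; exact hxy hyu.symm
  rw [← hu] at hy
  rw [← hv] at hz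
  have general (u₀ u₁) (h₀ : u₀ ∈ H) (h₁ : u₁ ∈ H) (hli : LinearIndependent ℂ ![u₀, u₁])
      (hB : B x u₀ = 0) : {w | w ∈ H ∧ f (x + w) = 0 ∧ ∀ k, D k (x + w) ≠ 0}.Infinite := by
    refine infinite_setOf_conic H f D h₀ h₁ hli (b := B x u₁) (q₀ := q u₀) (q₁ := B u₀ u₁)
      (q₂ := q u₁) (fun α β => ?_) hD
    simp only [f, q, B, map_add, LinearMap.map_smul, smul_eq_mul] at hB ⊢
    linear_combination hQx + α * hB
  by_cases hli : LinearIndependent ℂ ![u, v]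
  · by_cases hB : B x u = 0
    · exact general u v hy hz hli hB
    · refine general (B x u • v - B x v • u) u
        (H.sub_mem (H.smul_mem _ hz) (H.smul_mem _ hy)) hy ?_ ?_
      · rw [LinearIndependent.pair_iff] at hli ⊢
        intro s t hst
        have := hli (t - s * B x v) (s * B x u) (by
          rw [← hst, sub_smul, mul_smul, mul_smul, smul_sub]; abel)
        have hs : s = 0 := by simpa [hB] using this.2
        exact ⟨hs, by simpa [hs] using this.1⟩
      · simp only [B, map_sub, LinearMap.map_smul, smul_eq_mul]
        ring
  · obtain ⟨τ, rfl⟩ : ∃ τ : ℂ, τ • u = v := by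
      rw [LinearIndependent.pair_iff' hu0] at hli
      push Not at hli
      exact hli
    have hτ0 : τ ≠ 0 := by rintro rfl; simp at hzv; exact hxz hzv.symm
    have hτ1 : τ ≠ 1 := by rintro rfl; rw [hyu, hzv, one_smul] at hyz; exact hyz rfl
    subst hyu hzv
    have e1 : B x u + q u = 0 := by
      simp only [B, q, map_add] at hQy ⊢
      linear_combination hQy - hQx
    have e2 : B x u + τ * q u = 0 := by
      apply mul_left_cancel₀ hτ0
      simp only [B, q, map_add, LinearMap.map_smul, smul_eq_mul] at hQz ⊢
      linear_combination hQz - hQx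
    have hq : q u = 0 := by
      have : (τ - 1) * q u = 0 := by linear_combination e2 - e1
      exact (mul_eq_zero.1 this).resolve_left (sub_ne_zero.2 hτ1)
    refine infinite_setOf_line H f D hy hu0 (fun t => ?_) hD
    simp only [B, q, f, map_add, LinearMap.map_smul, smul_eq_mul] at e1 hq ⊢
    linear_combination hQx + t * (e1 - hq) + t ^ 2 * hq

/-- The determinant of homogeneous lifts of two points of `ℙ¹(ℂ)`, with `∞` lifted to `(1, 0)` and
a finite point `z` lifted to `(z, 1)`. -/
noncomputable def bracket : OnePoint ℂ → OnePoint ℂ → ℂ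
  | Option.none,   Option.none   => 0
  | Option.none,   Option.some _ => 1
  | Option.some _, Option.none   => -1
  | Option.some z, Option.some w => z - w

theorem bracket_self (p : OnePoint ℂ) : bracket p p = 0 := by
  rcases p with _ | p <;> simp [bracket]

theorem bracket_ne_zero {p q : OnePoint ℂ} (h : p ≠ q) : bracket p q ≠ 0 := by
  rcases p with _ | p <;> rcases q with _ | q
  · exact absurd rfl h
  · exact one_ne_zero
  · exact neg_ne_zero.2 one_ne_zero
  · exact sub_ne_zero.2 fun hpq => h (congrArg _ hpq)

theorem bracket_swap (p q : OnePoint ℂ) : bracket p q = -bracket q p := by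
  rcases p with _ | p <;> rcases q with _ | q <;> simp [bracket]

theorem bracket_plucker (p q r s : OnePoint ℂ) :
    bracket p q * bracket r s - bracket p r * bracket q s + bracket p s * bracket q r = 0 := by
  rcases p with _ | p <;> rcases q with _ | q <;> rcases r with _ | r <;> rcases s with _ | s <;>
    simp only [bracket] <;> ring

theorem CR_mul_bracket {p q r s : OnePoint ℂ} (hpq : p ≠ q) (hpr : p ≠ r) (hps : p ≠ s)
    (hqr : q ≠ r) (hqs : q ≠ s) (hrs : r ≠ s) :
    bracket r p * bracket s q = CR p q r s * (bracket r q * bracket s p) := by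
  have h₁ := bracket_ne_zero hqr.symm
  have h₂ := bracket_ne_zero hps.symm
  rcases p with _ | p <;> rcases q with _ | q <;> rcases r with _ | r <;> rcases s with _ | s <;>
    first
    | exact absurd rfl ‹_›
    | (simp only [bracket, CR] at h₁ h₂ ⊢; field_simp)

/-- The bracket of the `i`-th and `j`-th points in the affine chart in which point `v` is at
infinity, the points other than `v` have coordinates `w`, and `v` is lifted to `(s, 0)`. -/
def chartBracket {R : Type*} [CommRing R] (v : Fin 8) (s : R) (w : Fin 8 → R) (i j : Fin 8) : R :=
  if i = v then s else if j = v then -s else w i - w j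

theorem map_chartBracket {R S : Type*} [CommRing R] [CommRing S] (f : R →+* S) (v : Fin 8) (s : R)
    (w : Fin 8 → R) (i j : Fin 8) :
    f (chartBracket v s w i j) = chartBracket v (f s) (fun k => f (w k)) i j := by
  simp only [chartBracket]
  split_ifs <;> simp

/-- The bracket `chartBracket v (w d) w i j` as a linear form in `w`. -/
def chartForm (v d i j : Fin 8) : (Fin 8 → ℂ) →ₗ[ℂ] ℂ :=
  let P (k : Fin 8) : (Fin 8 → ℂ) →ₗ[ℂ] ℂ := LinearMap.proj k
  if i = v then P d else if j = v then -P d else P i - P j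

theorem chartForm_apply (v d i j : Fin 8) (w : Fin 8 → ℂ) :
    chartForm v d i j w = chartBracket v (w d) w i j := by
  simp only [chartForm, chartBracket]
  split_ifs <;> simp

/-- The coordinates of the points `p` in the affine chart sending `p v`, `p c`, `p d` to
`∞`, `0`, `1`. -/
noncomputable def chartCoord (v c d : Fin 8) (p : Fin 8 → OnePoint ℂ) (i : Fin 8) : ℂ :=
  if i = v then 0 else
    bracket (p i) (p c) * bracket (p d) (p v) / (bracket (p i) (p v) * bracket (p d) (p c))

theorem exists_chartBracket_chartCoord {v c d : Fin 8} (hcv : c ≠ v) (hdv : d ≠ v) (hdc : d ≠ c)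
    {p : Fin 8 → OnePoint ℂ} (hp : Function.Injective p) :
    ∃ (δ : ℂ) (μ : Fin 8 → ℂ), δ ≠ 0 ∧ (∀ i, μ i ≠ 0) ∧ ∀ i j, i ≠ j →
      chartBracket v 1 (chartCoord v c d p) i j = δ * μ i * μ j * bracket (p i) (p j) := by
  have hb {i j : Fin 8} (h : i ≠ j) : bracket (p i) (p j) ≠ 0 := bracket_ne_zero (hp.ne h)
  have h₁ := hb hcv
  have h₂ := hb hdv
  have h₃ := hb hdc
  obtain ⟨δ, hδ⟩ : ∃ δ, δ = bracket (p d) (p v) * bracket (p c) (p v) / bracket (p d) (p c) :=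
    ⟨_, rfl⟩
  have hδ0 : δ ≠ 0 := by rw [hδ]; positivity
  refine ⟨δ, fun i => if i = v then -δ⁻¹ else (bracket (p i) (p v))⁻¹, hδ0, fun i => ?_,
    fun i j hij => ?_⟩
  · dsimp only
    split_ifs with h
    · simpa using hδ0
    · exact inv_ne_zero (hb h)
  · simp only [chartBracket]
    by_cases hi : i = v
    · subst hi
      have h₄ := hb hij.symm
      rw [if_pos rfl, if_pos rfl, if_neg hij.symm, bracket_swap (p i)]
      field_simp
    · have h₄ := hb hi
      by_cases hj : j = v
      · subst hj
        rw [if_neg hi, if_pos rfl, if_neg hi, if_pos rfl]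
        field_simp
      · have h₅ := hb hj
        rw [if_neg hi, if_neg hj, if_neg hi, if_neg hj, chartCoord, chartCoord, if_neg hi,
          if_neg hj, hδ]
        field_simp
        linear_combination -bracket_plucker (p i) (p j) (p c) (p v)

/-- Configurations with cross-ratios `a`, in the chart sending points `v`, `c`, `d` to
`∞`, `0`, `1`. -/
def chartSolutions (T : Fin 5 → Fin 4 → Fin 8) (v c d : Fin 8) (a : Fin 5 → ℂ) :
    Set (Fin 8 → ℂ) :=
  {w | w v = 0 ∧ w c = 0 ∧ w d = 1 ∧ (∀ i j, i ≠ j → chartBracket v 1 w i j ≠ 0) ∧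
    ∀ i, chartBracket v 1 w (T i 2) (T i 0) * chartBracket v 1 w (T i 3) (T i 1) =
      a i * (chartBracket v 1 w (T i 2) (T i 1) * chartBracket v 1 w (T i 3) (T i 0))}

theorem chartCoord_mem_chartSolutions {T : Fin 5 → Fin 4 → Fin 8}
    (hT : ∀ i, Function.Injective (T i)) {v c d : Fin 8} (hcv : c ≠ v) (hdv : d ≠ v) (hdc : d ≠ c)
    {a : Fin 5 → ℂ} {p : Fin 8 → OnePoint ℂ} (hp : Function.Injective p)
    (ha : ∀ i, CR (p (T i 0)) (p (T i 1)) (p (T i 2)) (p (T i 3)) = a i) :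
    chartCoord v c d p ∈ chartSolutions T v c d a := by
  obtain ⟨δ, μ, hδ, hμ, h⟩ := exists_chartBracket_chartCoord hcv hdv hdc hp
  have hb {i j : Fin 8} (h : i ≠ j) : bracket (p i) (p j) ≠ 0 := bracket_ne_zero (hp.ne h)
  refine ⟨by simp [chartCoord], by simp [chartCoord, bracket_self], ?_, fun i j hij => ?_,
    fun i => ?_⟩
  · have h₁ := hb hdv
    have h₂ := hb hdc
    rw [chartCoord, if_neg hdv]
    field_simp
  · rw [h i j hij]
    exact mul_ne_zero (mul_ne_zero (mul_ne_zero hδ (hμ i)) (hμ j)) (hb hij)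
  · have hne {j k : Fin 4} (hjk : j ≠ k) : T i j ≠ T i k := (hT i).ne hjk
    have hCR := CR_mul_bracket (hp.ne (hne (show (0 : Fin 4) ≠ 1 by decide)))
      (hp.ne (hne (show (0 : Fin 4) ≠ 2 by decide))) (hp.ne (hne (show (0 : Fin 4) ≠ 3 by decide)))
      (hp.ne (hne (show (1 : Fin 4) ≠ 2 by decide))) (hp.ne (hne (show (1 : Fin 4) ≠ 3 by decide)))
      (hp.ne (hne (show (2 : Fin 4) ≠ 3 by decide)))
    rw [ha i] at hCR
    rw [h _ _ (hne (by decide)), h _ _ (hne (by decide)), h _ _ (hne (by decide)),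
      h _ _ (hne (by decide))]
    linear_combination δ ^ 2 * μ (T i 0) * μ (T i 1) * μ (T i 2) * μ (T i 3) * hCR

theorem chartCoord_injOn {v c d : Fin 8} (hcv : c ≠ v) (hdv : d ≠ v) (hdc : d ≠ c) :
    Set.InjOn (chartCoord v c d) {p | Function.Injective p ∧ p 0 = ∞ ∧
      p 1 = ((0 : ℂ) : OnePoint ℂ) ∧ p 2 = ((1 : ℂ) : OnePoint ℂ)} := by
  have key {p : Fin 8 → OnePoint ℂ} (hp : Function.Injective p) (h0 : p 0 = ∞)
      (h1 : p 1 = ((0 : ℂ) : OnePoint ℂ)) (h2 : p 2 = ((1 : ℂ) : OnePoint ℂ)) {i : Fin 8}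
      (hi0 : i ≠ 0) (hi1 : i ≠ 1) : p i = ((chartBracket v 1 (chartCoord v c d p) i 1 *
        chartBracket v 1 (chartCoord v c d p) 2 0 / (chartBracket v 1 (chartCoord v c d p) i 0 *
        chartBracket v 1 (chartCoord v c d p) 2 1) : ℂ) : OnePoint ℂ) := by
    obtain ⟨δ, μ, hδ, hμ, h⟩ := exists_chartBracket_chartCoord hcv hdv hdc hp
    rw [h _ _ hi0, h _ _ hi1, h 2 0 (by decide), h 2 1 (by decide)]
    have hne : p i ≠ ∞ := fun h => hi0 (hp (h.trans h0.symm))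
    obtain ⟨z, hz⟩ := OnePoint.ne_infty_iff_exists.1 hne
    have e₁ : bracket (p i) (p 1) = z := by rw [← hz, h1]; exact sub_zero z
    have e₂ : bracket (p i) (p 0) = -1 := by rw [← hz, h0]; rfl
    have e₃ : bracket (p 2) (p 0) = -1 := by rw [h2, h0]; rfl
    have e₄ : bracket (p 2) (p 1) = 1 := by rw [h2, h1]; exact sub_zero 1
    rw [e₁, e₂, e₃, e₄, ← hz]
    have := hμ 0
    have := hμ 1
    have := hμ 2
    have := hμ i
    congr 1
    field_simp
  rintro p ⟨hp, hp0, hp1, hp2⟩ q ⟨hq, hq0, hq1, hq2⟩ hpq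
  funext i
  by_cases hi0 : i = 0
  · rw [hi0, hp0, hq0]
  by_cases hi1 : i = 1
  · rw [hi1, hp1, hq1]
  rw [key hp hp0 hp1 hp2 hi0 hi1, key hq hq0 hq1 hq2 hi0 hi1, hpq]

theorem exists_finite_chartSolutions (T : Fin 5 → Fin 4 → Fin 8)
    (hT : ∀ i, Function.Injective (T i)) {v c d : Fin 8} (hcv : c ≠ v) (hdv : d ≠ v)
    (hdc : d ≠ c) : ∃ q : MvPolynomial (Fin 5) ℂ, q ≠ 0 ∧
      ∀ a, MvPolynomial.eval a q ≠ 0 → (chartSolutions T v c d a).Finite := by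
  let σ := {k : Fin 8 // k ∉ ({v, c, d} : Finset (Fin 8))}
  have hσ : Fintype.card σ = 5 := by
    rw [Fintype.card_subtype_compl, Fintype.card_fin, Fintype.card_coe,
      Finset.card_eq_three.2 ⟨v, c, d, hcv.symm, hdv.symm, hdc.symm, rfl⟩]
  let W {R : Type} [CommRing R] (x : σ → R) (k : Fin 8) : R :=
    if h : k ∉ ({v, c, d} : Finset (Fin 8)) then x ⟨k, h⟩ else if k = d then 1 else 0
  let b (i j : Fin 8) : MvPolynomial σ ℂ := chartBracket v 1 (W MvPolynomial.X) i j
  have hb (x : σ → ℂ) (i j : Fin 8) :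
      MvPolynomial.eval x (b i j) = chartBracket v 1 (W x) i j := by
    rw [map_chartBracket, map_one]
    congr 1
    funext k
    simp only [W]
    split_ifs <;> simp
  obtain ⟨q, hq, hfin⟩ := MvPolynomial.exists_finite_fiber (σ := σ) (ι := Fin 5) (by simp [hσ])
    (fun i => b (T i 2) (T i 0) * b (T i 3) (T i 1))
    (fun i => b (T i 2) (T i 1) * b (T i 3) (T i 0))
  refine ⟨q, hq, fun a ha => ((hfin a ha).image fun x => W x).subset ?_⟩
  rintro w ⟨hwv, hwc, hwd, hne, hw⟩
  have hW : W (fun k : σ => w k) = w := by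
    funext k
    simp only [W]
    split_ifs with h₁ h₂
    · rw [h₂]
      exact hwd.symm
    · have : k = v ∨ k = c := by simpa [h₂] using h₁
      rcases this with rfl | rfl
      · exact hwv.symm
      · exact hwc.symm
    · rfl
  refine ⟨fun k => w k, fun i => ?_, hW⟩
  simp only [map_mul, hb, hW]
  exact ⟨mul_ne_zero (hne _ _ ((hT i).ne (by decide))) (hne _ _ ((hT i).ne (by decide))), hw i⟩

/-- A cross-ratio constraint involving the point at infinity is linear in affine coordinates. -/
theorem exists_linear_crossRatio {e : Fin 4 → Fin 8} (he : Function.Injective e) {v : Fin 8}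
    (hv : ∃ j, e j = v) (a : ℂ) : ∃ L : (Fin 8 → ℂ) →ₗ[ℂ] ℂ, ∀ w,
      (chartBracket v 1 w (e 2) (e 0) * chartBracket v 1 w (e 3) (e 1) =
        a * (chartBracket v 1 w (e 2) (e 1) * chartBracket v 1 w (e 3) (e 0)) ↔ L w = 0) := by
  obtain ⟨j, rfl⟩ := hv
  let P (i : Fin 8) : (Fin 8 → ℂ) →ₗ[ℂ] ℂ := LinearMap.proj i
  fin_cases j
  · refine ⟨-(P (e 3) - P (e 1)) + a • (P (e 2) - P (e 1)), fun w => ?_⟩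
    simp [chartBracket, he.eq_iff, P]
    grind
  · refine ⟨-(P (e 2) - P (e 0)) + a • (P (e 3) - P (e 0)), fun w => ?_⟩
    simp [chartBracket, he.eq_iff, P]
    grind
  · refine ⟨(P (e 3) - P (e 1)) - a • (P (e 3) - P (e 0)), fun w => ?_⟩
    simp [chartBracket, he.eq_iff, P]
    grind
  · refine ⟨(P (e 2) - P (e 0)) - a • (P (e 2) - P (e 1)), fun w => ?_⟩
    simp [chartBracket, he.eq_iff, P]
    grind

/-- A finite solution set has at most two points if all but one constraint involve the point at
infinity. -/
theorem ncard_chartSolutions_le_two {T : Fin 5 → Fin 4 → Fin 8}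
    (hT : ∀ i, Function.Injective (T i)) {v c d : Fin 8} {i₀ : Fin 5}
    (hv : ∀ i, i ≠ i₀ → ∃ j, T i j = v) {a : Fin 5 → ℂ}
    (hfin : (chartSolutions T v c d a).Finite) : (chartSolutions T v c d a).ncard ≤ 2 := by
  by_contra! hcard
  obtain ⟨x, hx, y, hy, z, hz, hxy, hxz, hyz⟩ := (Set.two_lt_ncard hfin).1 hcard
  choose! L hL using fun i (hi : i ≠ i₀) => exists_linear_crossRatio (hT i) (hv i hi) (a i)
  let P (i : Fin 8) : (Fin 8 → ℂ) →ₗ[ℂ] ℂ := LinearMap.proj i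
  let H : Submodule ℂ (Fin 8 → ℂ) := (P v).ker ⊓ (P c).ker ⊓ (P d).ker ⊓
    ⨅ i : {i // i ≠ i₀}, (L i).ker
  have mem_H (u) : u ∈ H ↔ u v = 0 ∧ u c = 0 ∧ u d = 0 ∧ ∀ i, i ≠ i₀ → L i u = 0 := by
    simp [H, P, and_assoc]
  have sub_mem {w} (hw : w ∈ chartSolutions T v c d a) : w - x ∈ H := by
    obtain ⟨hxv, hxc, hxd, -, hxe⟩ := hx
    obtain ⟨hwv, hwc, hwd, -, hwe⟩ := hw
    rw [mem_H]
    refine ⟨by simp [hxv, hwv], by simp [hxc, hwc], by simp [hxd, hwd], fun i hi => ?_⟩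
    rw [map_sub, (hL i hi x).1 (hxe i), (hL i hi w).1 (hwe i), sub_zero]
  have form {w : Fin 8 → ℂ} (hw : w d = 1) (i j : Fin 8) :
      chartForm v d i j w = chartBracket v 1 w i j := by rw [chartForm_apply, hw]
  have quadric {w} (hw : w ∈ chartSolutions T v c d a) :
      chartForm v d (T i₀ 2) (T i₀ 0) w * chartForm v d (T i₀ 3) (T i₀ 1) w =
        a i₀ * (chartForm v d (T i₀ 2) (T i₀ 1) w * chartForm v d (T i₀ 3) (T i₀ 0) w) := by
    simp only [form hw.2.2.1]
    exact hw.2.2.2.2 i₀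
  have hinf := infinite_of_three_points H _ _ _ _ _
    (fun k : {k : Fin 8 × Fin 8 // k.1 ≠ k.2} => chartForm v d k.1.1 k.1.2) hxy hxz hyz
    (sub_mem hy) (sub_mem hz) (quadric hx) (quadric hy) (quadric hz)
    (fun k => by rw [form hx.2.2.1]; exact hx.2.2.2.1 _ _ k.2)
  refine (hinf.image (add_right_injective x).injOn) (hfin.subset ?_)
  rintro _ ⟨u, ⟨hu, hQ, hD⟩, rfl⟩
  obtain ⟨hxv, hxc, hxd, -, hxe⟩ := hx
  obtain ⟨huv, huc, hud, hue⟩ := (mem_H u).1 hu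
  have hd : (x + u) d = 1 := by simp [hxd, hud]
  refine ⟨by simp [hxv, huv], by simp [hxc, huc], hd, fun i j hij => ?_, fun i => ?_⟩
  · rw [← form hd]
    exact hD ⟨(i, j), hij⟩
  · by_cases hi : i = i₀
    · subst hi
      simp only [form hd] at hQ
      exact sub_eq_zero.1 hQ
    · rw [hL i hi, map_add, (hL i hi x).1 (hxe i), hue i hi, add_zero]

/-- If some vertex belongs to at least four of the five tuples of the datum,
the cross-ratio degree is at most 2. -/
theorem crossRatioDegree_le_two_of_vertex_deg_ge_four
    (T : Fin 5 → Fin 4 → Fin 8)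
    (hT : ∀ i, Function.Injective (T i))
    (hcov : ∀ v : Fin 8, ∃ i j, T i j = v)
    (hv : ∃ v : Fin 8, 4 ≤ degT T v) :
    ∃ q : MvPolynomial (Fin 5) ℂ, q ≠ 0 ∧
      ∀ a : Fin 5 → ℂ, (∀ i, a i ≠ 0 ∧ a i ≠ 1) → MvPolynomial.eval a q ≠ 0 →
        let S : Set (Fin 8 → OnePoint ℂ) :=
          {p | Function.Injective p ∧ p 0 = ∞ ∧ p 1 = ((0 : ℂ) : OnePoint ℂ) ∧
            p 2 = ((1 : ℂ) : OnePoint ℂ) ∧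
            ∀ i, CR (p (T i 0)) (p (T i 1)) (p (T i 2)) (p (T i 3)) = a i}
        S.Finite ∧ S.ncard ≤ 2 := by
  obtain ⟨v, hv⟩ := hv
  obtain ⟨c, d, hcv, hdv, hdc⟩ : ∃ c d : Fin 8, c ≠ v ∧ d ≠ v ∧ d ≠ c := by
    clear hv
    revert v
    decide
  obtain ⟨i₀, hi₀⟩ : ∃ i₀ : Fin 5, ∀ i, i ≠ i₀ → ∃ j, T i j = v := by
    have hcard : (Finset.univ.filter fun i => ¬ ∃ j, T i j = v).card ≤ 1 := by
      have := Finset.card_filter_add_card_filter_not (s := (Finset.univ : Finset (Fin 5)))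
        (fun i => ∃ j, T i j = v)
      rw [Finset.card_univ, Fintype.card_fin] at this
      unfold degT at hv
      omega
    obtain ⟨i₀, hi₀⟩ := Finset.card_le_one_iff_subset_singleton.1 hcard
    refine ⟨i₀, fun i hi => ?_⟩
    by_contra h
    exact hi (Finset.mem_singleton.1 (hi₀ (Finset.mem_filter.2 ⟨Finset.mem_univ i, h⟩)))
  obtain ⟨q, hq, hfin⟩ := exists_finite_chartSolutions T hT hcv hdv hdc
  refine ⟨q, hq, fun a _ hqa => ?_⟩
  intro S
  have maps : Set.MapsTo (chartCoord v c d) S (chartSolutions T v c d a) :=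
    fun p hp => chartCoord_mem_chartSolutions hT hcv hdv hdc hp.1 hp.2.2.2.2
  have inj : Set.InjOn (chartCoord v c d) S := by
    refine (chartCoord_injOn hcv hdv hdc).mono ?_
    rintro p ⟨hp, h0, h1, h2, -⟩
    exact ⟨hp, h0, h1, h2⟩
  exact ⟨Set.Finite.of_injOn maps inj (hfin a hqa),
    (Set.ncard_le_ncard_of_injOn _ maps inj (hfin a hqa)).trans
      (ncard_chartSolutions_le_two hT hi₀ (hfin a hqa))⟩
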